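/- arXiv:2403.07378 — 4 statements merged into one kernel-verified Lean document; each statement's English description precedes it below -/
import Mathlib

section
/- Let X be a real m × L matrix and S an invertible real m × m matrix with S Sᵀ = X Xᵀ. Let u ∈ ℝ^k and v ∈ ℝ^m be unit vectors and σ ≥ 0. Then the compression loss of truncating the single singular value σ satisfies ‖σ · u vᵀ S⁻¹ X‖_F = σ. -/
open Matrix

/-- The Frobenius norm of a real matrix. -/
noncomputable def frobeniusNorm {m n : ℕ} (A : Matrix (Fin m) (Fin n) ℝ) : ℝ :=
  Real.sqrt (∑ i, ∑ j, |A i j| ^ 2)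

/-- The Frobenius norm is the square root of the trace of `A Aᵀ`. -/
theorem frobeniusNorm_eq_sqrt_trace {m n : ℕ} (A : Matrix (Fin m) (Fin n) ℝ) :
    frobeniusNorm A = Real.sqrt (A * Aᵀ).trace := by
  simp [frobeniusNorm, Matrix.trace, Matrix.mul_apply, sq]

/-- If `S` is invertible and `S Sᵀ = X Xᵀ`, then `S⁻¹ X` has orthonormal rows. -/
theorem inv_mul_mul_transpose_eq_one {m L : ℕ}
    {X : Matrix (Fin m) (Fin L) ℝ} {S : Matrix (Fin m) (Fin m) ℝ}
    (hS : IsUnit S) (hSSt : S * Sᵀ = X * Xᵀ) :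
    (S⁻¹ * X) * (S⁻¹ * X)ᵀ = 1 := by
  have hdet : IsUnit S.det := (Matrix.isUnit_iff_isUnit_det S).mp hS
  calc (S⁻¹ * X) * (S⁻¹ * X)ᵀ = S⁻¹ * (X * Xᵀ) * (S⁻¹)ᵀ := by
        simp only [Matrix.transpose_mul, Matrix.mul_assoc]
    _ = (S⁻¹ * S) * (S⁻¹ * S)ᵀ := by
        rw [← hSSt]; simp only [Matrix.transpose_mul, Matrix.mul_assoc]
    _ = 1 := by simp [Matrix.nonsing_inv_mul S hdet]

/-- Theorem 3.2: if `S` is invertible with `S Sᵀ = X Xᵀ`, `u` and `v` are unit vectors and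
`σ ≥ 0`, then the compression loss of truncating the single singular value `σ` satisfies
`‖σ u vᵀ S⁻¹ X‖_F = σ`. -/
theorem loss_single_singular_value {k m L : ℕ}
    (X : Matrix (Fin m) (Fin L) ℝ) (S : Matrix (Fin m) (Fin m) ℝ)
    (hS : IsUnit S) (hSSt : S * Sᵀ = X * Xᵀ)
    (u : Fin k → ℝ) (v : Fin m → ℝ) (hu : u ⬝ᵥ u = 1) (hv : v ⬝ᵥ v = 1)
    (σ : ℝ) (hσ : 0 ≤ σ) :
    frobeniusNorm (σ • (vecMulVec u v * S⁻¹ * X)) = σ := by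
  have key : (vecMulVec u v * S⁻¹ * X) * (vecMulVec u v * S⁻¹ * X)ᵀ = vecMulVec u u := by
    calc (vecMulVec u v * S⁻¹ * X) * (vecMulVec u v * S⁻¹ * X)ᵀ
        = vecMulVec u v * ((S⁻¹ * X) * (S⁻¹ * X)ᵀ) * (vecMulVec u v)ᵀ := by
          simp only [Matrix.transpose_mul, Matrix.mul_assoc]
      _ = vecMulVec u u := by
          rw [inv_mul_mul_transpose_eq_one hS hSSt, Matrix.mul_one, transpose_vecMulVec,
            vecMulVec_mul_vecMulVec, hv, one_smul]
  rw [frobeniusNorm_eq_sqrt_trace, transpose_smul, Matrix.smul_mul, Matrix.mul_smul, key,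
    trace_smul, trace_smul, trace_vecMulVec, hu, smul_eq_mul, smul_eq_mul, mul_one,
    Real.sqrt_mul_self hσ]
end

section
/- Let X be a real m × L matrix and S an invertible real m × m matrix with S Sᵀ = X Xᵀ. Let σ : Fin r → ℝ with σ_i ≥ 0, let u_1, …, u_r ∈ ℝ^k be an orthonormal family and v_1, …, v_r ∈ ℝ^m be an orthonormal family. Then for any index set T ⊆ Fin r, ‖Σ_{i ∈ T} σ_i u_i v_iᵀ S⁻¹ X‖_F² = Σ_{i ∈ T} σ_i². -/
open Matrix

theorem frobeniusNorm_sq_eq_trace {m n : ℕ} (A : Matrix (Fin m) (Fin n) ℝ) :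
    frobeniusNorm A ^ 2 = (A * Aᵀ).trace := by
  rw [frobeniusNorm, Real.sq_sqrt (by positivity)]
  simp [Matrix.trace, Matrix.mul_apply, sq]

/-- A matrix product `M * S⁻¹ * X` has the same Gram matrix as `M` when `S` whitens `X`. -/
theorem mul_inv_mul_mul_transpose_of_whitening {k m L : ℕ}
    (M : Matrix (Fin k) (Fin m) ℝ) (X : Matrix (Fin m) (Fin L) ℝ)
    (S : Matrix (Fin m) (Fin m) ℝ) (hS : IsUnit S) (hSSt : S * Sᵀ = X * Xᵀ) :
    (M * S⁻¹ * X) * (M * S⁻¹ * X)ᵀ = M * Mᵀ := by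
  have hdet : IsUnit S.det := (Matrix.isUnit_iff_isUnit_det S).1 hS
  have hinv : S⁻¹ * S = 1 := Matrix.nonsing_inv_mul S hdet
  have hinvT : Sᵀ * S⁻¹ᵀ = 1 := by rw [← Matrix.transpose_mul, hinv, Matrix.transpose_one]
  calc (M * S⁻¹ * X) * (M * S⁻¹ * X)ᵀ = M * S⁻¹ * (X * Xᵀ) * (S⁻¹ᵀ * Mᵀ) := by
        simp only [Matrix.transpose_mul, Matrix.mul_assoc]
    _ = M * (S⁻¹ * S) * (Sᵀ * S⁻¹ᵀ) * Mᵀ := by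
        rw [← hSSt]; simp only [Matrix.mul_assoc]
    _ = M * Mᵀ := by rw [hinv, hinvT, Matrix.mul_one, Matrix.mul_one]

/-- Loss formula in the proof of Corollary 3.3: if `S` is invertible with `S Sᵀ = X Xᵀ`,
`σ_i ≥ 0`, and `(u_i)`, `(v_i)` are orthonormal families, then for any index set `T`,
`‖Σ_{i ∈ T} σ_i u_i v_iᵀ S⁻¹ X‖_F² = Σ_{i ∈ T} σ_i²`. -/
theorem sq_loss_eq_sum_sq_singular_values {r k m L : ℕ}
    (X : Matrix (Fin m) (Fin L) ℝ) (S : Matrix (Fin m) (Fin m) ℝ)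
    (hS : IsUnit S) (hSSt : S * Sᵀ = X * Xᵀ)
    (σ : Fin r → ℝ) (hσ : ∀ i, 0 ≤ σ i)
    (u : Fin r → Fin k → ℝ) (v : Fin r → Fin m → ℝ)
    (hu : ∀ i j, u i ⬝ᵥ u j = if i = j then 1 else 0)
    (hv : ∀ i j, v i ⬝ᵥ v j = if i = j then 1 else 0)
    (T : Finset (Fin r)) :
    frobeniusNorm (∑ i ∈ T, σ i • (vecMulVec (u i) (v i) * S⁻¹ * X)) ^ 2 =
      ∑ i ∈ T, σ i ^ 2 := by
  have hfactor : ∑ i ∈ T, σ i • (vecMulVec (u i) (v i) * S⁻¹ * X) =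
      (∑ i ∈ T, σ i • vecMulVec (u i) (v i)) * S⁻¹ * X := by
    simp only [Matrix.sum_mul, Matrix.smul_mul]
  rw [hfactor, frobeniusNorm_sq_eq_trace, mul_inv_mul_mul_transpose_of_whitening _ X S hS hSSt]
  simp only [Matrix.transpose_sum, Matrix.transpose_smul, transpose_vecMulVec, Matrix.sum_mul,
    Matrix.mul_sum, Matrix.smul_mul, Matrix.mul_smul, vecMulVec_mul_vecMulVec, Matrix.trace_sum,
    Matrix.trace_smul, trace_vecMulVec, dotProduct_smul, hu, hv, smul_eq_mul]
  refine Finset.sum_congr rfl fun i hi => ?_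
  simp [hi, sq]
end

section
/- Let X be a real m × L matrix and S an invertible real m × m matrix with S Sᵀ = X Xᵀ. Let σ : Fin r → ℝ with σ_i ≥ 0, let u_1, …, u_r ∈ ℝ^k be an orthonormal family and v_1, …, v_r ∈ ℝ^m be an orthonormal family. Suppose T, T' ⊆ Fin r are index sets of the same cardinality such that σ_i ≤ σ_j for every i ∈ T and j ∈ T'. Then ‖Σ_{i ∈ T} σ_i u_i v_iᵀ S⁻¹ X‖_F ≤ ‖Σ_{j ∈ T'} σ_j u_j v_jᵀ S⁻¹ X‖_F; in particular, truncating the smallest singular values yields the minimal compression loss among all truncations of the same size. -/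
open Matrix

/-- Whitening preserves the Frobenius norm. -/
theorem frobeniusNorm_mul_inv_mul {k m L : ℕ} (M : Matrix (Fin k) (Fin m) ℝ)
    {X : Matrix (Fin m) (Fin L) ℝ} {S : Matrix (Fin m) (Fin m) ℝ}
    (hS : IsUnit S) (hSX : S * Sᵀ = X * Xᵀ) :
    frobeniusNorm (M * S⁻¹ * X) = frobeniusNorm M := by
  have hdet : IsUnit S.det := (Matrix.isUnit_iff_isUnit_det S).mp hS
  have hwhite : S⁻¹ * X * (S⁻¹ * X)ᵀ = 1 := by
    calc S⁻¹ * X * (S⁻¹ * X)ᵀ = S⁻¹ * (X * Xᵀ) * (S⁻¹)ᵀ := by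
          simp only [Matrix.transpose_mul, Matrix.mul_assoc]
      _ = (S⁻¹ * S) * (S⁻¹ * S)ᵀ := by
          rw [← hSX]; simp only [Matrix.transpose_mul, Matrix.mul_assoc]
      _ = 1 := by rw [Matrix.nonsing_inv_mul S hdet]; simp
  rw [frobeniusNorm_eq_sqrt_trace, frobeniusNorm_eq_sqrt_trace, Matrix.mul_assoc M,
    Matrix.transpose_mul M, Matrix.mul_assoc M, ← Matrix.mul_assoc (S⁻¹ * X), hwhite,
    Matrix.one_mul]

theorem frobeniusNorm_sum_smul_vecMulVec {ι : Type*} [DecidableEq ι] {k m : ℕ} (σ : ι → ℝ)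
    (u : ι → Fin k → ℝ) (v : ι → Fin m → ℝ)
    (hu : ∀ i j, u i ⬝ᵥ u j = if i = j then 1 else 0)
    (hv : ∀ i j, v i ⬝ᵥ v j = if i = j then 1 else 0) (T : Finset ι) :
    frobeniusNorm (∑ i ∈ T, σ i • vecMulVec (u i) (v i)) = Real.sqrt (∑ i ∈ T, σ i ^ 2) := by
  rw [frobeniusNorm_eq_sqrt_trace]
  congr 1
  simp only [Matrix.transpose_sum, Matrix.transpose_smul, Matrix.transpose_vecMulVec,
    Matrix.sum_mul, Matrix.mul_sum, Matrix.trace_sum, Matrix.smul_mul, Matrix.mul_smul,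
    Matrix.vecMulVec_mul_vecMulVec, Matrix.trace_smul, Matrix.trace_vecMulVec, hu, hv,
    dotProduct_smul, smul_eq_mul]
  refine Finset.sum_congr rfl fun i hi => ?_
  simp [hi, sq]

theorem sum_le_sum_of_card_eq {ι : Type*} {f : ι → ℝ} {T T' : Finset ι}
    (hcard : T.card = T'.card) (hle : ∀ i ∈ T, ∀ j ∈ T', f i ≤ f j) :
    ∑ i ∈ T, f i ≤ ∑ j ∈ T', f j := by
  let e := Finset.equivOfCardEq hcard
  rw [← Finset.sum_coe_sort T, ← Finset.sum_coe_sort T', ← e.sum_comp]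
  exact Finset.sum_le_sum fun i _ => hle i i.2 (e i) (e i).2

/-- Corollary 3.3: under truncation-aware data whitening (`S Sᵀ = X Xᵀ` with `S`
invertible), truncating smaller singular values gives smaller compression loss: if `T`
and `T'` have the same cardinality and `σ_i ≤ σ_j` for all `i ∈ T`, `j ∈ T'`, then
`‖Σ_{i ∈ T} σ_i u_i v_iᵀ S⁻¹ X‖_F ≤ ‖Σ_{j ∈ T'} σ_j u_j v_jᵀ S⁻¹ X‖_F`. -/
theorem truncating_smallest_singular_values_minimal_loss {r k m L : ℕ}
    (X : Matrix (Fin m) (Fin L) ℝ) (S : Matrix (Fin m) (Fin m) ℝ)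
    (hS : IsUnit S) (hSSt : S * Sᵀ = X * Xᵀ)
    (σ : Fin r → ℝ) (hσ : ∀ i, 0 ≤ σ i)
    (u : Fin r → Fin k → ℝ) (v : Fin r → Fin m → ℝ)
    (hu : ∀ i j, u i ⬝ᵥ u j = if i = j then 1 else 0)
    (hv : ∀ i j, v i ⬝ᵥ v j = if i = j then 1 else 0)
    (T T' : Finset (Fin r)) (hcard : T.card = T'.card)
    (hle : ∀ i ∈ T, ∀ j ∈ T', σ i ≤ σ j) :
    frobeniusNorm (∑ i ∈ T, σ i • (vecMulVec (u i) (v i) * S⁻¹ * X)) ≤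
      frobeniusNorm (∑ j ∈ T', σ j • (vecMulVec (u j) (v j) * S⁻¹ * X)) := by
  have hloss : ∀ T : Finset (Fin r),
      frobeniusNorm (∑ i ∈ T, σ i • (vecMulVec (u i) (v i) * S⁻¹ * X)) =
        Real.sqrt (∑ i ∈ T, σ i ^ 2) := fun T => by
    rw [← frobeniusNorm_sum_smul_vecMulVec σ u v hu hv T,
      ← frobeniusNorm_mul_inv_mul _ hS hSSt]
    simp only [Matrix.sum_mul, Matrix.smul_mul]
  rw [hloss, hloss]
  exact Real.sqrt_le_sqrt <| sum_le_sum_of_card_eq hcard fun i hi j hj =>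
    pow_le_pow_left₀ (hσ i) (hle i hi j hj) 2
end

section
/- Let X be a real m × L matrix and S an invertible real m × m matrix with S Sᵀ = X Xᵀ. Let W be a real k × m matrix such that W S = Σ_{i=1}^r σ_i u_i v_iᵀ, where σ_i ≥ 0, (u_i) ⊆ ℝ^k is an orthonormal family, and (v_i) ⊆ ℝ^m is an orthonormal family. For an index set T ⊆ {1, …, r}, define the compressed weight W' = (Σ_{i ∉ T} σ_i u_i v_iᵀ) S⁻¹. Then the compression loss satisfies ‖W X − W' X‖_F² = Σ_{i ∈ T} σ_i². -/
open Matrix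

/-- The Frobenius norm of `M * X` depends on `X` only through its Gram matrix `X * Xᵀ`. -/
theorem frobeniusNorm_mul_sq_eq_of_mul_transpose_eq {k m n p : ℕ}
    (M : Matrix (Fin k) (Fin m) ℝ) {X : Matrix (Fin m) (Fin n) ℝ} {Y : Matrix (Fin m) (Fin p) ℝ}
    (h : X * Xᵀ = Y * Yᵀ) :
    frobeniusNorm (M * X) ^ 2 = frobeniusNorm (M * Y) ^ 2 := by
  have gram {q : ℕ} (Z : Matrix (Fin m) (Fin q) ℝ) :
      M * Z * (M * Z)ᵀ = M * (Z * Zᵀ) * Mᵀ := by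
    simp only [Matrix.transpose_mul, Matrix.mul_assoc]
  rw [frobeniusNorm_sq_eq_trace, frobeniusNorm_sq_eq_trace, gram, gram, h]

theorem frobeniusNorm_sum_smul_vecMulVec_sq {ι : Type*} [DecidableEq ι] {k m : ℕ} (σ : ι → ℝ)
    {u : ι → Fin k → ℝ} {v : ι → Fin m → ℝ}
    (hu : ∀ i j, u i ⬝ᵥ u j = if i = j then 1 else 0)
    (hv : ∀ i j, v i ⬝ᵥ v j = if i = j then 1 else 0) (T : Finset ι) :
    frobeniusNorm (∑ i ∈ T, σ i • vecMulVec (u i) (v i)) ^ 2 = ∑ i ∈ T, σ i ^ 2 := by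
  rw [frobeniusNorm_sq_eq_trace]
  simp only [Matrix.transpose_sum, Matrix.transpose_smul, Matrix.transpose_vecMulVec,
    Matrix.trace_sum, Matrix.smul_mul, Matrix.mul_smul, Matrix.trace_smul,
    Matrix.vecMulVec_mul_vecMulVec, Matrix.trace_vecMulVec, Matrix.sum_mul, Matrix.mul_sum,
    dotProduct_smul, hu, hv, smul_eq_mul]
  refine Finset.sum_congr rfl fun i hi => ?_
  simp [hi, sq]

/-- Truncation-aware data whitening guarantee of SVD-LLM: if `S Sᵀ = X Xᵀ` with `S`
invertible, `W S = Σ_i σ_i u_i v_iᵀ` is an SVD of the whitened weight, and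
`W' = (Σ_{i ∉ T} σ_i u_i v_iᵀ) S⁻¹` is the compressed weight obtained by truncating the
singular values indexed by `T`, then `‖W X − W' X‖_F² = Σ_{i ∈ T} σ_i²`. -/
theorem svdllm_compression_loss {r k m L : ℕ}
    (X : Matrix (Fin m) (Fin L) ℝ) (S : Matrix (Fin m) (Fin m) ℝ)
    (hS : IsUnit S) (hSSt : S * Sᵀ = X * Xᵀ)
    (W : Matrix (Fin k) (Fin m) ℝ)
    (σ : Fin r → ℝ) (hσ : ∀ i, 0 ≤ σ i)
    (u : Fin r → Fin k → ℝ) (v : Fin r → Fin m → ℝ)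
    (hu : ∀ i j, u i ⬝ᵥ u j = if i = j then 1 else 0)
    (hv : ∀ i j, v i ⬝ᵥ v j = if i = j then 1 else 0)
    (hW : W * S = ∑ i, σ i • vecMulVec (u i) (v i))
    (T : Finset (Fin r))
    (W' : Matrix (Fin k) (Fin m) ℝ)
    (hW' : W' = (∑ i ∈ Tᶜ, σ i • vecMulVec (u i) (v i)) * S⁻¹) :
    frobeniusNorm (W * X - W' * X) ^ 2 = ∑ i ∈ T, σ i ^ 2 := by
  have hMS : (W - W') * S = ∑ i ∈ T, σ i • vecMulVec (u i) (v i) := by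
    rw [Matrix.sub_mul, hW, hW', Matrix.mul_assoc,
      Matrix.nonsing_inv_mul S ((Matrix.isUnit_iff_isUnit_det S).mp hS), Matrix.mul_one,
      sub_eq_iff_eq_add, Finset.sum_add_sum_compl]
  rw [← Matrix.sub_mul, frobeniusNorm_mul_sq_eq_of_mul_transpose_eq (W - W') hSSt.symm, hMS,
    frobeniusNorm_sum_smul_vecMulVec_sq σ hu hv]
end
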